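/- arXiv:2409.20505 — 3 statements merged into one kernel-verified Lean document; each statement's English description precedes it below -/
import Mathlib

section
/- Let G be a finite connected simple graph and let u be a vertex of G such that deleting u disconnects G into connected components with vertex sets A_1, …, A_k; let G_i denote the subgraph of G induced on A_i ∪ {u}. Then for the Closed Geodetic Game, 𝒢(G, {u}) = 𝒢(G_1, {u}) ⊕ ⋯ ⊕ 𝒢(G_k, {u}), where ⊕ denotes nim-sum (bitwise XOR of nonnegative integers). -/
open SimpleGraph

/-- mex: least nonnegative integer not in the set. -/
noncomputable def mex (X : Set ℕ) : ℕ := sInf Xᶜ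

/-- The interval `I(u,v)`: vertices on some shortest `u`–`v` path. -/
def geodInterval {V : Type*} (G : SimpleGraph V) (u v : V) : Set V :=
  {w | G.dist u w + G.dist w v = G.dist u v}

/-- The geodetic closure `(S)`. -/
def geodClosure {V : Type*} (G : SimpleGraph V) (S : Set V) : Set V :=
  ⋃ u ∈ S, ⋃ v ∈ S, geodInterval G u v

/-- Sprague–Grundy value of the Closed Geodetic Game on `G` with selected set `S`. -/
noncomputable def grundy {V : Type*} [Fintype V] [DecidableEq V]
    (G : SimpleGraph V) (S : Finset V) : ℕ :=
  mex (Set.range fun v : {v : V // v ∉ geodClosure G ↑S} =>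
    grundy G (insert v.1 S))
termination_by Sᶜ.card
decreasing_by
  have hv : (v : V) ∉ S := by
    intro h
    exact v.2 (Set.mem_biUnion (by simpa using h)
      (Set.mem_biUnion (by simpa using h) (by simp [geodInterval])))
  simp only [Finset.compl_insert]
  exact Finset.card_erase_lt_of_mem (by simpa using hv)

theorem mex_notMem {X : Set ℕ} (hX : X.Finite) : mex X ∉ X :=
  Nat.sInf_mem hX.infinite_compl.nonempty

theorem mem_of_lt_mex {X : Set ℕ} {m : ℕ} (h : m < mex X) : m ∈ X :=
  not_not.1 (Nat.notMem_of_lt_sInf h)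

theorem mex_eq {X : Set ℕ} {n : ℕ} (hn : n ∉ X) (h : ∀ m < n, m ∈ X) : mex X = n :=
  le_antisymm (Nat.sInf_le hn) (le_csInf ⟨n, hn⟩ fun m hm => not_lt.1 fun hlt => hm (h m hlt))

section Grundy

variable {V : Type*} [Fintype V] [DecidableEq V] {G : SimpleGraph V} {S : Finset V}

theorem grundy_insert_ne {v : V} (hv : v ∉ geodClosure G ↑S) :
    grundy G (insert v S) ≠ grundy G S := by
  intro h
  conv_rhs at h => rw [grundy]
  exact mex_notMem (Set.finite_range fun v : {v // v ∉ geodClosure G ↑S} =>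
    grundy G (insert v.1 S)) ⟨⟨v, hv⟩, h⟩

theorem exists_grundy_insert_eq {m : ℕ} (hm : m < grundy G S) :
    ∃ v ∉ geodClosure G ↑S, grundy G (insert v S) = m := by
  rw [grundy] at hm
  obtain ⟨v, hv⟩ := mem_of_lt_mex hm
  exact ⟨v.1, v.2, hv⟩

theorem grundy_eq {n : ℕ} (hne : ∀ v ∉ geodClosure G ↑S, grundy G (insert v S) ≠ n)
    (hlt : ∀ m < n, ∃ v ∉ geodClosure G ↑S, grundy G (insert v S) = m) :
    grundy G S = n := by
  rw [grundy]
  refine mex_eq ?_ fun m hm => ?_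
  · rintro ⟨v, hv⟩
    exact hne v.1 v.2 hv
  · obtain ⟨v, hv, h⟩ := hlt m hm
    exact ⟨⟨v, hv⟩, h⟩

end Grundy

theorem mem_geodClosure {V : Type*} {G : SimpleGraph V} {S : Set V} {w : V} :
    w ∈ geodClosure G S ↔ ∃ a ∈ S, ∃ b ∈ S, G.dist a w + G.dist w b = G.dist a b := by
  simp [geodClosure, geodInterval]

theorem subset_geodClosure {V : Type*} (G : SimpleGraph V) (S : Set V) : S ⊆ geodClosure G S :=
  fun w hw => mem_geodClosure.2 ⟨w, hw, w, hw, by simp⟩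

/-- The nim-sum of a finite family. -/
def nimSum {k : ℕ} (x : Fin k → ℕ) : ℕ := (List.ofFn x).foldr (· ^^^ ·) 0

theorem nimSum_succ {k : ℕ} (x : Fin (k + 1) → ℕ) :
    nimSum x = x 0 ^^^ nimSum fun i : Fin k => x i.succ := by
  simp [nimSum, List.ofFn_succ]

theorem exists_lt_of_lt_nimSum {k : ℕ} {x : Fin k → ℕ} {m : ℕ} (h : m < nimSum x) :
    ∃ i, nimSum x ^^^ x i ^^^ m < x i := by
  induction k generalizing m with
  | zero => simp [nimSum] at h
  | succ k ih =>
    rw [nimSum_succ] at h ⊢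
    set c := nimSum fun i : Fin k => x i.succ with hc
    rcases Nat.lt_xor_cases h with h | h
    · refine ⟨0, ?_⟩
      rwa [Nat.xor_comm (x 0) c, Nat.xor_xor_cancel_right, Nat.xor_comm]
    · obtain ⟨i, hi⟩ := ih h
      refine ⟨i.succ, ?_⟩
      convert hi using 1
      rw [← hc]
      ac_rfl

theorem nimSum_eq_of_forall_ne {k : ℕ} {x y : Fin k → ℕ} (i : Fin k)
    (h : ∀ j, j ≠ i → y j = x j) : nimSum y = nimSum x ^^^ x i ^^^ y i := by
  induction k with
  | zero => exact i.elim0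
  | succ k ih =>
    rw [nimSum_succ, nimSum_succ]
    cases i using Fin.cases with
    | zero =>
      have : (fun i : Fin k => y i.succ) = fun i : Fin k => x i.succ :=
        funext fun j => h _ (Fin.succ_ne_zero j)
      rw [this, Nat.xor_comm (x 0), Nat.xor_xor_cancel_right, Nat.xor_comm]
    | succ i =>
      rw [ih i fun j hj => h _ fun e => hj (Fin.succ_injective _ e),
        h 0 (Fin.succ_ne_zero i).symm]
      ac_rfl

/-- The vertex `u` is the only one through which walks can enter or leave the set `A`. -/
def IsGate {V : Type*} (G : SimpleGraph V) (u : V) (A : Set V) : Prop :=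
  u ∉ A ∧ ∀ a ∈ A, ∀ b, G.Adj a b → b ∈ insert u A

namespace IsGate

variable {V : Type*} {G : SimpleGraph V} {u : V} {A : Set V}

theorem dist_eq_add (h : IsGate G u A) (hG : G.Connected) {a b : V} (ha : a ∈ insert u A)
    (hb : b ∉ A) : G.dist a b = G.dist a u + G.dist u b := by
  classical
  rcases ha with rfl | ha
  · simp
  refine le_antisymm hG.dist_triangle ?_
  obtain ⟨p, hp⟩ := hG.exists_walk_length_eq_dist a b
  obtain ⟨d, hd, hd₁, hd₂⟩ := p.exists_boundary_dart A ha hb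
  have hdu : d.snd = u := (h.2 _ hd₁ _ d.adj).resolve_right hd₂
  have hu : u ∈ p.support := hdu ▸ p.dart_snd_mem_support_of_mem_darts hd
  rw [← hp, ← congrArg Walk.length (p.take_spec hu), Walk.length_append]
  exact add_le_add (dist_le _) (dist_le _)

open Classical in
/-- Collapse everything outside `A` to `u`. -/
noncomputable def retract (u : V) (A : Set V) (x : V) : ↥(insert u A) :=
  if hx : x ∈ insert u A then ⟨x, hx⟩ else ⟨u, Set.mem_insert u A⟩

theorem retract_coe (x : ↥(insert u A)) : retract u A x = x := by
  simp only [retract, x.2, dite_true]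

theorem retract_of_notMem {x : V} (hx : x ∉ A) :
    retract u A x = ⟨u, Set.mem_insert u A⟩ := by
  unfold retract
  split_ifs with h
  · exact Subtype.ext (h.resolve_right hx)
  · rfl

theorem exists_walk_retract (h : IsGate G u A) {x y : V} (p : G.Walk x y) :
    ∃ q : (G.induce (insert u A)).Walk (retract u A x) (retract u A y), q.length ≤ p.length := by
  induction p with
  | nil => exact ⟨.nil, le_rfl⟩
  | @cons a b c hab p ih =>
    obtain ⟨q, hq⟩ := ih
    by_cases hc : a ∈ insert u A ∧ b ∈ insert u A
    · have hadj : (G.induce (insert u A)).Adj (retract u A a) (retract u A b) := by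
        rw [retract_coe ⟨a, hc.1⟩, retract_coe ⟨b, hc.2⟩]
        exact hab
      exact ⟨.cons hadj q, by simpa using hq⟩
    · have ha : a ∉ A := fun ha => hc ⟨.inr ha, h.2 a ha b hab⟩
      have hb : b ∉ A := fun hb => hc ⟨h.2 b hb a hab.symm, .inr hb⟩
      have e : retract u A b = retract u A a := by
        rw [retract_of_notMem ha, retract_of_notMem hb]
      exact ⟨q.copy e rfl, by simpa using hq.trans (Nat.le_succ _)⟩

theorem dist_induce (h : IsGate G u A) (hG : G.Connected) (x y : ↥(insert u A)) :
    (G.induce (insert u A)).dist x y = G.dist x y := by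
  obtain ⟨p, hp⟩ := hG.exists_walk_length_eq_dist (x : V) y
  obtain ⟨q, hq⟩ := h.exists_walk_retract p
  replace hq : (q.copy (retract_coe x) (retract_coe y)).length ≤ p.length := by simpa using hq
  generalize q.copy (retract_coe x) (retract_coe y) = q' at hq
  refine le_antisymm ?_ ?_
  · exact hp ▸ (dist_le q').trans hq
  · obtain ⟨r, hr⟩ := q'.reachable.exists_walk_length_eq_dist
    rw [← hr, ← r.length_map (Embedding.induce (insert u A)).toHom]
    exact dist_le _

theorem mem_geodClosure_induce_iff (h : IsGate G u A) (hG : G.Connected) {S : Set V}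
    (hu : u ∈ S) (w : ↥(insert u A)) :
    w ∈ geodClosure (G.induce (insert u A)) (Subtype.val ⁻¹' S) ↔ (w : V) ∈ geodClosure G S := by
  simp only [mem_geodClosure, h.dist_induce hG]
  constructor
  · rintro ⟨a, ha, b, hb, e⟩
    exact ⟨a, ha, b, hb, e⟩
  · rintro ⟨a, ha, b, hb, e⟩
    let u' : ↥(insert u A) := ⟨u, Set.mem_insert u A⟩
    by_cases haA : a ∈ A <;> by_cases hbA : b ∈ A
    · exact ⟨⟨a, .inr haA⟩, ha, ⟨b, .inr hbA⟩, hb, e⟩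
    · refine ⟨⟨a, .inr haA⟩, ha, u', hu, ?_⟩
      have h₁ := h.dist_eq_add hG w.2 hbA
      have h₂ := h.dist_eq_add hG (.inr haA) hbA
      change G.dist a w + G.dist w u = G.dist a u
      omega
    · refine ⟨u', hu, ⟨b, .inr hbA⟩, hb, ?_⟩
      have h₁ := h.dist_eq_add hG w.2 haA
      have h₂ := h.dist_eq_add hG (.inr hbA) haA
      change G.dist u w + G.dist w b = G.dist u b
      rw [G.dist_comm (u := u), G.dist_comm (u := u), G.dist_comm (u := w) (v := b)]
      rw [G.dist_comm (u := a) (v := w), G.dist_comm (u := a) (v := b),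
        G.dist_comm (u := w) (v := b)] at e
      omega
    · refine ⟨u', hu, u', hu, ?_⟩
      have h₁ := h.dist_eq_add hG w.2 haA
      have h₂ := h.dist_eq_add hG w.2 hbA
      have h₃ : G.dist a b ≤ G.dist a u + G.dist u b := hG.dist_triangle
      change G.dist u w + G.dist w u = G.dist u u
      rw [G.dist_comm (u := u) (v := w), dist_self]
      rw [G.dist_comm (u := a) (v := w)] at e
      rw [G.dist_comm (u := a) (v := u)] at h₃
      omega

end IsGate

section Sum

variable {V : Type*} [DecidableEq V] {G : SimpleGraph V} {u : V}

/-- The position that `S` induces on `A ∪ {u}`. -/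
def partTrace (u : V) (A S : Finset V) : Finset ((insert u A : Finset V) : Set V) :=
  Finset.univ.filter fun x => x.1 ∈ S

theorem mem_partTrace {A S : Finset V} {x : ((insert u A : Finset V) : Set V)} :
    x ∈ partTrace u A S ↔ x.1 ∈ S :=
  Finset.mem_filter_univ x

/-- The Grundy value of the position that `S` induces on `A ∪ {u}`. -/
noncomputable def partGrundy (G : SimpleGraph V) (u : V) (A S : Finset V) : ℕ :=
  grundy (G.induce ((insert u A : Finset V) : Set V)) (partTrace u A S)

theorem partGrundy_insert_of_notMem {A S : Finset V} {v : V} (hv : v ∉ insert u A) :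
    partGrundy G u A (insert v S) = partGrundy G u A S := by
  unfold partGrundy
  congr 1
  ext x
  have : x.1 ≠ v := fun e => hv (e ▸ Finset.mem_coe.1 x.2)
  simp only [mem_partTrace, Finset.mem_insert, this, false_or]

theorem partGrundy_insert_of_mem {A S : Finset V}
    (v : ((insert u A : Finset V) : Set V)) :
    partGrundy G u A (insert v.1 S) =
      grundy (G.induce ((insert u A : Finset V) : Set V)) (insert v (partTrace u A S)) := by
  unfold partGrundy
  congr 1
  ext x
  simp only [mem_partTrace, Finset.mem_insert, Subtype.ext_iff]

theorem mem_geodClosure_part_iff {A : Finset V} (h : IsGate G u (A : Set V)) (hG : G.Connected)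
    {S : Finset V} (hu : u ∈ S) (w : ((insert u A : Finset V) : Set V)) :
    w ∈ geodClosure (G.induce ((insert u A : Finset V) : Set V))
        (partTrace u A S : Set ((insert u A : Finset V) : Set V)) ↔
      (w : V) ∈ geodClosure G (S : Set V) := by
  have key := h.mem_geodClosure_induce_iff hG (S := (S : Set V)) hu
  revert w
  have e : (partTrace u A S : Set ((insert u A : Finset V) : Set V)) =
      Subtype.val ⁻¹' (S : Set V) := by
    ext; exact mem_partTrace
  rw [e]
  rw [← Finset.coe_insert] at key
  exact key

theorem grundy_eq_nimSum [Fintype V] {k : ℕ} {A : Fin k → Finset V} (hG : G.Connected)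
    (hA : ∀ i, IsGate G u (A i : Set V))
    (hpart : ∀ v : V, v ≠ u → ∃! i : Fin k, v ∈ A i) (S : Finset V) (hS : u ∈ S) :
    grundy G S = nimSum fun i => partGrundy G u (A i) S := by
  induction hn : Sᶜ.card using Nat.strong_induction_on generalizing S with
  | _ n ih =>
  subst hn
  have mem_part {v : V} (hv : v ∉ geodClosure G ↑S) : v ≠ u := by
    rintro rfl
    exact hv (subset_geodClosure G _ hS)
  have option {v : V} {i : Fin k} (hv : v ∉ geodClosure G ↑S) (hi : v ∈ A i) :
      grundy G (insert v S) = (nimSum fun i => partGrundy G u (A i) S) ^^^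
        partGrundy G u (A i) S ^^^ partGrundy G u (A i) (insert v S) := by
    have hvS : v ∉ S := fun h => hv (subset_geodClosure G _ h)
    rw [ih _ ?_ (insert v S) (Finset.mem_insert_of_mem hS) rfl]
    · refine nimSum_eq_of_forall_ne i fun j hj => partGrundy_insert_of_notMem ?_
      rw [Finset.mem_insert, not_or]
      exact ⟨mem_part hv, fun h => hj ((hpart v (mem_part hv)).unique h hi)⟩
    · rw [Finset.compl_insert]
      exact Finset.card_erase_lt_of_mem (by simpa using hvS)
  refine grundy_eq (fun v hv => ?_) fun m hm => ?_
  · obtain ⟨i, hi, -⟩ := hpart v (mem_part hv)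
    rw [option hv hi, Nat.xor_assoc]
    intro h
    let v' : ((insert u (A i) : Finset V) : Set V) := ⟨v, by simp [hi]⟩
    refine grundy_insert_ne (mt (mem_geodClosure_part_iff (hA i) hG hS v').1 hv) ?_
    rw [← partGrundy_insert_of_mem]
    exact (Nat.xor_eq_zero_iff.1 (Nat.xor_right_injective (h.trans (Nat.xor_zero _).symm))).symm
  · obtain ⟨i, hi⟩ := exists_lt_of_lt_nimSum hm
    obtain ⟨v, hv, e⟩ := exists_grundy_insert_eq hi
    rw [mem_geodClosure_part_iff (hA i) hG hS] at hv
    rw [← partGrundy_insert_of_mem] at e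
    refine ⟨v, hv, ?_⟩
    rw [option hv ((Finset.mem_insert.1 (Finset.mem_coe.1 v.2)).resolve_left (mem_part hv)), e,
      Nat.xor_xor_cancel_left]

end Sum

/-- if deleting the vertex `u` splits `G` into connected components
`A 0, …, A (k-1)`, then the Grundy value of the Closed Geodetic Game on `G` with `u`
selected is the nim-sum (bitwise XOR) of the Grundy values of the games on the
subgraphs induced on `A i ∪ {u}` with `u` selected. -/
theorem grundy_cut_vertex {V : Type*} [Fintype V] [DecidableEq V] (G : SimpleGraph V)
    (hG : G.Connected) (u : V) (k : ℕ) (A : Fin k → Finset V)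
    (hpart : ∀ v : V, v ≠ u → ∃! i : Fin k, v ∈ A i)
    (hu : ∀ i, u ∉ A i)
    (hconn : ∀ i, (G.induce (A i : Set V)).Connected)
    (hsep : ∀ i j : Fin k, i ≠ j → ∀ a ∈ A i, ∀ b ∈ A j, ¬ G.Adj a b)
    (hdisc : 2 ≤ k) :
    grundy G {u} =
      (List.ofFn fun i : Fin k =>
        grundy (G.induce ((insert u (A i) : Finset V) : Set V))
          {⟨u, by simp⟩}).foldr (· ^^^ ·) 0 := by
  have hA (i : Fin k) : IsGate G u (A i : Set V) := by
    refine ⟨by simpa using hu i, fun a ha b hab => ?_⟩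
    by_cases hb : b = u
    · exact .inl hb
    obtain ⟨j, hj, -⟩ := hpart b hb
    by_cases hij : i = j
    · exact .inr (hij ▸ hj)
    · exact absurd hab (hsep i j hij a ha b hj)
  rw [grundy_eq_nimSum hG hA hpart {u} (Finset.mem_singleton_self u), nimSum]
  congr 2
  funext i
  unfold partGrundy
  congr 1
  ext x
  rw [mem_partTrace, Finset.mem_singleton, Finset.mem_singleton, Subtype.ext_iff]
end

section
/- Let k ≥ 1 and let C_{2k+1} be the cycle on 2k+1 vertices u_0, …, u_{2k} in cyclic order. For every i with 1 ≤ i ≤ k, the geodetic closure of {u_0, u_i, u_{k+i}} is the whole vertex set of C_{2k+1}; i.e., {u_0, u_i, u_{k+i}} is a geodetic set of C_{2k+1}. -/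
open SimpleGraph

theorem cycleGraph_val_cases_of_adj {n : ℕ} {u v : Fin n} (h : (cycleGraph n).Adj u v) :
    u.val + 1 = v.val ∨ v.val + 1 = u.val ∨ (u.val = 0 ∧ v.val + 1 = n) ∨
      (v.val = 0 ∧ u.val + 1 = n) := by
  have hu := u.isLt
  have hv := v.isLt
  rw [cycleGraph_adj'] at h
  rcases lt_or_ge u v with huv | huv
  · rw [Fin.coe_sub_iff_lt.mpr huv, Fin.coe_sub_iff_le.mpr huv.le] at h
    rw [Fin.lt_def] at huv
    omega
  · rcases huv.lt_or_eq with hvu | rfl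
    · rw [Fin.coe_sub_iff_lt.mpr hvu, Fin.coe_sub_iff_le.mpr hvu.le] at h
      rw [Fin.lt_def] at hvu
      omega
    · exact absurd h (by rw [Fin.coe_sub_iff_le.mpr le_rfl]; omega)

theorem cycleGraph_le_walk_length {n : ℕ} {u v : Fin n} (p : (cycleGraph n).Walk u v) :
    min (max u.val v.val - min u.val v.val) (n - (max u.val v.val - min u.val v.val))
      ≤ p.length := by
  induction p with
  | nil => simp
  | @cons u v w h p ih =>
    have := cycleGraph_val_cases_of_adj h
    have hu := u.isLt
    have hv := v.isLt
    have hw := w.isLt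
    rw [Walk.length_cons]
    omega

theorem cycleGraph_dist_le_sub {n : ℕ} {u v : Fin n} (h : u ≤ v) :
    (cycleGraph n).dist u v ≤ v.val - u.val := by
  obtain ⟨a, ha⟩ := u
  obtain ⟨b, hb⟩ := v
  rw [Fin.mk_le_mk] at h
  induction b, h using Nat.le_induction with
  | base => simp
  | succ b hab ih =>
    have hadj : (cycleGraph n).Adj ⟨b, by omega⟩ ⟨b + 1, hb⟩ :=
      pathGraph_le_cycleGraph (pathGraph_adj.mpr (.inl rfl))
    have htri := (cycleGraph_preconnected (⟨a, ha⟩ : Fin n) ⟨b, by omega⟩).dist_triangle_left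
      ⟨b + 1, hb⟩
    rw [dist_eq_one_iff_adj.mpr hadj] at htri
    have := ih (by omega)
    dsimp only at this ⊢
    omega

/-- The distance in a cycle graph is the length of the shorter of the two arcs. -/
theorem cycleGraph_dist_of_le {n : ℕ} {u v : Fin n} (h : u ≤ v) :
    (cycleGraph n).dist u v = min (v.val - u.val) (n - (v.val - u.val)) := by
  have hu := u.isLt
  have hv := v.isLt
  refine le_antisymm (le_min (cycleGraph_dist_le_sub h) ?_) ?_
  · let first : Fin n := ⟨0, by omega⟩
    let last : Fin n := ⟨n - 1, by omega⟩
    have hends : (cycleGraph n).dist first last ≤ 1 := by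
      rcases Nat.lt_or_ge 1 n with hn | hn
      · refine (dist_eq_one_iff_adj.mpr (cycleGraph_adj'.mpr (.inl ?_))).le
        have hlt : first < last := Fin.mk_lt_mk.mpr (by omega)
        rw [Fin.coe_sub_iff_lt.mpr hlt]
        dsimp only [first, last]
        omega
      · have : first = last := Fin.ext (by dsimp only [first, last]; omega)
        simp [this]
    have hfirst : (cycleGraph n).dist first u ≤ u.val :=
      cycleGraph_dist_le_sub (Nat.zero_le u.val)
    have hlast : (cycleGraph n).dist v last ≤ n - 1 - v.val :=
      cycleGraph_dist_le_sub (Fin.le_def.mpr (Nat.le_sub_one_of_lt hv))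
    have htri₁ := (cycleGraph_preconnected u first).dist_triangle_left v
    have htri₂ := (cycleGraph_preconnected first last).dist_triangle_left v
    rw [dist_comm] at hfirst hlast
    rw [Fin.le_def] at h
    omega
  · obtain ⟨p, hp⟩ := (cycleGraph_preconnected u v).exists_walk_length_eq_dist
    have := cycleGraph_le_walk_length p
    rw [Fin.le_def] at h
    omega

/-- in the odd cycle `C_{2k+1}` (`k ≥ 1`), for `1 ≤ i ≤ k`, the set
`{u_0, u_i, u_{k+i}}` is a geodetic set. -/
theorem odd_cycle_geodetic (k : ℕ) (hk : 1 ≤ k) (i : ℕ) (hi1 : 1 ≤ i) (hik : i ≤ k) :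
    geodClosure (SimpleGraph.cycleGraph (2 * k + 1))
      ({(0 : Fin (2 * k + 1)), ⟨i, by omega⟩, ⟨k + i, by omega⟩} : Set (Fin (2 * k + 1)))
      = Set.univ := by
  refine Set.eq_univ_of_forall fun w => ?_
  have hw := w.isLt
  simp only [geodClosure, Set.mem_iUnion, exists_prop]
  rcases le_total w.val i with hwi | hiw
  · refine ⟨0, by simp, ⟨i, by omega⟩, by simp, ?_⟩
    rw [geodInterval, Set.mem_ofPred_eq, cycleGraph_dist_of_le (Fin.zero_le _),
      cycleGraph_dist_of_le (Fin.le_def.mpr hwi), cycleGraph_dist_of_le (Fin.zero_le _)]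
    simp only [Fin.val_zero]
    omega
  rcases le_total w.val (k + i) with hwki | hkiw
  · refine ⟨⟨i, by omega⟩, by simp, ⟨k + i, by omega⟩, by simp, ?_⟩
    rw [geodInterval, Set.mem_ofPred_eq, cycleGraph_dist_of_le (Fin.le_def.mpr hiw),
      cycleGraph_dist_of_le (Fin.le_def.mpr hwki),
      cycleGraph_dist_of_le (Fin.mk_le_mk.mpr (by omega))]
    dsimp only
    omega
  · refine ⟨⟨k + i, by omega⟩, by simp, 0, by simp, ?_⟩
    rw [geodInterval, Set.mem_ofPred_eq, cycleGraph_dist_of_le (Fin.le_def.mpr hkiw),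
      dist_comm (v := 0), dist_comm (v := 0), cycleGraph_dist_of_le (Fin.zero_le _),
      cycleGraph_dist_of_le (Fin.zero_le _)]
    simp only [Fin.val_zero]
    omega
end

section
/- For every positive integer n, the Sprague–Grundy value of the Closed Geodetic Game on the path P_n is 𝒢(P_n) = n mod 2. -/
open SimpleGraph

theorem mex_eq_of_notMem_of_forall_lt {X : Set ℕ} {m : ℕ} (hm : m ∉ X)
    (h : ∀ k < m, k ∈ X) : mex X = m :=
  le_antisymm (Nat.sInf_le hm) <| le_csInf ⟨m, hm⟩ fun k hk => by
    by_contra! hlt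
    exact hk (h k hlt)

theorem exists_walk_pathGraph_length_eq {n : ℕ} (d : ℕ) (u v : Fin n) (h : u.val + d = v.val) :
    ∃ p : (pathGraph n).Walk u v, p.length = d := by
  induction d generalizing u with
  | zero =>
    obtain rfl : u = v := Fin.ext h
    exact ⟨.nil, rfl⟩
  | succ d ih =>
    obtain ⟨p, hp⟩ := ih ⟨u.val + 1, by omega⟩ (by simp only; omega)
    exact ⟨.cons (pathGraph_adj.2 (.inl rfl)) p, by simp [hp]⟩

theorem val_le_val_add_length_of_walk_pathGraph {n : ℕ} {u v : Fin n}
    (p : (pathGraph n).Walk u v) : v.val ≤ u.val + p.length := by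
  induction p with
  | nil => simp
  | cons h p ih =>
    rw [pathGraph_adj] at h
    rw [Walk.length_cons]
    omega

theorem dist_pathGraph_of_le {n : ℕ} {u v : Fin n} (h : u ≤ v) :
    (pathGraph n).dist u v = v.val - u.val := by
  obtain ⟨p, hp⟩ := exists_walk_pathGraph_length_eq (v.val - u.val) u v (by omega)
  obtain ⟨q, hq⟩ := (pathGraph_preconnected n u v).exists_walk_length_eq_dist
  have hle := dist_le p
  have hge := val_le_val_add_length_of_walk_pathGraph q
  omega

theorem dist_pathGraph {n : ℕ} (u v : Fin n) :
    (pathGraph n).dist u v = (v.val - u.val) + (u.val - v.val) := by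
  rcases le_total u v with h | h
  · rw [dist_pathGraph_of_le h]
    omega
  · rw [dist_comm, dist_pathGraph_of_le h]
    omega

theorem mem_geodClosure_pathGraph {n : ℕ} {S : Set (Fin n)} {a b : Fin n}
    (ha : IsLeast S a) (hb : IsGreatest S b) (w : Fin n) :
    w ∈ geodClosure (pathGraph n) S ↔ a ≤ w ∧ w ≤ b := by
  simp only [geodClosure, geodInterval, Set.mem_iUnion, Set.mem_ofPred_eq, dist_pathGraph,
    exists_prop]
  constructor
  · rintro ⟨u, hu, v, hv, h⟩
    have hau := ha.2 hu
    have hav := ha.2 hv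
    have hub := hb.2 hu
    have hvb := hb.2 hv
    omega
  · rintro ⟨haw, hwb⟩
    exact ⟨a, ha.1, b, hb.1, by omega⟩

theorem grundy_pathGraph_of_isLeast_isGreatest {n : ℕ} {S : Finset (Fin n)} {a b : Fin n}
    (ha : IsLeast (S : Set (Fin n)) a) (hb : IsGreatest (S : Set (Fin n)) b) :
    grundy (pathGraph n) S = a.val ^^^ (n - 1 - b.val) := by
  induction hk : a.val + (n - 1 - b.val) using Nat.strong_induction_on generalizing S a b with
  | _ k ih =>
  subst hk
  have hab : a ≤ b := ha.2 hb.1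
  have left (v : Fin n) (hv : v < a) :
      grundy (pathGraph n) (insert v S) = v.val ^^^ (n - 1 - b.val) := by
    refine ih _ (by omega) (a := v) (b := b) ?_ ?_ rfl
    · simpa [min_eq_left hv.le] using ha.insert v
    · simpa [max_eq_right (hv.le.trans hab)] using hb.insert v
  have right (v : Fin n) (hv : b < v) :
      grundy (pathGraph n) (insert v S) = a.val ^^^ (n - 1 - v.val) := by
    refine ih _ (by omega) (a := a) (b := v) ?_ ?_ rfl
    · simpa [min_eq_right (hab.trans hv.le)] using ha.insert v
    · simpa [max_eq_left hv.le] using hb.insert v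
  rw [grundy]
  apply mex_eq_of_notMem_of_forall_lt
  · rintro ⟨⟨v, hv⟩, h⟩
    rw [mem_geodClosure_pathGraph ha hb, not_and_or, not_le, not_le] at hv
    rcases hv with hv | hv
    · have := Nat.xor_left_injective ((left v hv).symm.trans h)
      omega
    · have := Nat.xor_right_injective ((right v hv).symm.trans h)
      omega
  · intro k hk
    rcases Nat.lt_xor_cases hk with h | h
    · refine ⟨⟨⟨k ^^^ (n - 1 - b.val), h.trans a.2⟩, ?_⟩, ?_⟩
      · rw [mem_geodClosure_pathGraph ha hb]
        exact fun hv => hv.1.not_gt h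
      · exact (left _ h).trans (Nat.xor_xor_cancel_right _ _)
    · have hb' : b < ⟨n - 1 - (k ^^^ a.val), by omega⟩ := by
        simp only [Fin.lt_def]
        omega
      refine ⟨⟨_, ?_⟩, (right _ hb').trans ?_⟩
      · rw [mem_geodClosure_pathGraph ha hb]
        exact fun hv => hv.2.not_gt hb'
      · have hsub : n - 1 - (n - 1 - (k ^^^ a.val)) = k ^^^ a.val := by omega
        simp only [hsub]
        rw [Nat.xor_comm k, Nat.xor_xor_cancel_left]

/-- the Grundy value of the Closed Geodetic Game on the path `P n` is
`n % 2`. -/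
theorem grundy_path (n : ℕ) (hn : 1 ≤ n) :
    grundy (SimpleGraph.pathGraph n) (∅ : Finset (Fin n)) = n % 2 := by
  have single (v : Fin n) :
      grundy (pathGraph n) (insert v ∅) = v.val ^^^ (n - 1 - v.val) :=
    grundy_pathGraph_of_isLeast_isGreatest (by simp) (by simp)
  rw [grundy]
  apply mex_eq_of_notMem_of_forall_lt
  · rintro ⟨v, h⟩
    have hmod := Nat.xor_mod_two_eq (m := v.1.val) (n := n - 1 - v.1.val)
    rw [(single v.1).symm.trans h] at hmod
    omega
  · intro k hk
    refine ⟨⟨⟨n / 2, by omega⟩, by simp [geodClosure]⟩, (single _).trans ?_⟩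
    have hsub : n - 1 - n / 2 = n / 2 := by omega
    simp only [hsub, Nat.xor_self]
    omega
end
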